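/- Let q, n ≥ 0 and suppose μ ∈ V_{q+n} satisfies conditions (h1), (h3) and (h4). Then for every block-diagonal h = [[h_q, 0],[0, k]] with h_q ∈ GL_q(ℝ) and k ∈ O(n) (i.e. kᵀk = I), the bracket h.μ also satisfies conditions (h1), (h3) and (h4). In other words, the subgroup GL_q(ℝ) × O(n) of GL_{q+n}(ℝ) leaves the set of brackets satisfying (h1), (h3), (h4) invariant. -/

import Mathlib

open scoped BigOperators

noncomputable section

/-- Euclidean space `ℝ^m` as functions `Fin m → ℝ`. -/
abbrev Eu (m : ℕ) := Fin m → ℝ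

/-- The space of bilinear maps `ℝ^{q+n} × ℝ^{q+n} → ℝ^{q+n}`. -/
abbrev Bil (q n : ℕ) := Eu (q + n) →ₗ[ℝ] Eu (q + n) →ₗ[ℝ] Eu (q + n)

/-- Skew-symmetry: membership in `V_{q+n}`. -/
def Skew (q n : ℕ) (μ : Bil q n) : Prop := ∀ x y, μ x y = - μ y x

/-- Membership in the `ℝ^q`-factor (first `q` coordinates). -/
def inK (q n : ℕ) (x : Eu (q + n)) : Prop := ∀ i : Fin (q + n), q ≤ (i : ℕ) → x i = 0

/-- Membership in the `ℝ^n`-factor (last `n` coordinates). -/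
def inP (q n : ℕ) (x : Eu (q + n)) : Prop := ∀ i : Fin (q + n), (i : ℕ) < q → x i = 0

/-- The canonical inner product. -/
def dotE (m : ℕ) (x y : Eu m) : ℝ := ∑ i, x i * y i

/-- Condition (h1): Jacobi identity, `μ(ℝ^q,ℝ^q) ⊆ ℝ^q` and `μ(ℝ^q,ℝ^n) ⊆ ℝ^n`. -/
def H1 (q n : ℕ) (μ : Bil q n) : Prop :=
  (∀ x y z, μ x (μ y z) + μ y (μ z x) + μ z (μ x y) = 0) ∧
  (∀ x y, inK q n x → inK q n y → inK q n (μ x y)) ∧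
  (∀ x y, inK q n x → inP q n y → inP q n (μ x y))

/-- Condition (h3): `ad_μ z|_{ℝ^n}` is skew-symmetric for every `z ∈ ℝ^q`. -/
def H3 (q n : ℕ) (μ : Bil q n) : Prop :=
  ∀ z x y, inK q n z → inP q n x → inP q n y →
    dotE (q + n) (μ z x) y = - dotE (q + n) x (μ z y)

/-- Condition (h4): almost-effectiveness. -/
def H4 (q n : ℕ) (μ : Bil q n) : Prop :=
  ∀ z, inK q n z → (∀ x, inP q n x → μ z x = 0) → z = 0

/-- Inclusion `ℝ^q → ℝ^{q+n}` onto the first `q` coordinates. -/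
def emK (q n : ℕ) : Eu q →ₗ[ℝ] Eu (q + n) where
  toFun z := fun i => if h : (i : ℕ) < q then z ⟨i, h⟩ else 0
  map_add' x y := by funext i; by_cases h : (i : ℕ) < q <;> simp [h]
  map_smul' c x := by funext i; by_cases h : (i : ℕ) < q <;> simp [h]

/-- Inclusion `ℝ^n → ℝ^{q+n}` onto the last `n` coordinates. -/
def emP (q n : ℕ) : Eu n →ₗ[ℝ] Eu (q + n) where
  toFun x := fun i => if h : q ≤ (i : ℕ) then x ⟨(i : ℕ) - q, by have := i.isLt; omega⟩ else 0
  map_add' x y := by funext i; by_cases h : q ≤ (i : ℕ) <;> simp [h]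
  map_smul' c x := by funext i; by_cases h : q ≤ (i : ℕ) <;> simp [h]

/-- Projection `ℝ^{q+n} → ℝ^q` (first `q` coordinates). -/
def prK (q n : ℕ) : Eu (q + n) →ₗ[ℝ] Eu q where
  toFun v := fun i => v ⟨(i : ℕ), by have := i.isLt; omega⟩
  map_add' x y := rfl
  map_smul' c x := rfl

/-- Projection `ℝ^{q+n} → ℝ^n` (last `n` coordinates). -/
def prP (q n : ℕ) : Eu (q + n) →ₗ[ℝ] Eu n where
  toFun v := fun i => v ⟨q + (i : ℕ), by have := i.isLt; omega⟩
  map_add' x y := rfl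
  map_smul' c x := rfl

/-- The restriction `ad_μ z|_{ℝ^n} : ℝ^n → ℝ^n` for `z ∈ ℝ^q`. -/
def restAdP (q n : ℕ) (μ : Bil q n) (z : Eu q) : Eu n →ₗ[ℝ] Eu n :=
  (prP q n) ∘ₗ (μ (emK q n z)) ∘ₗ (emP q n)

/-- The restriction `ad_μ z|_{ℝ^q} : ℝ^q → ℝ^q` for `z ∈ ℝ^q`. -/
def restAdK (q n : ℕ) (μ : Bil q n) (z : Eu q) : Eu q →ₗ[ℝ] Eu q :=
  (prK q n) ∘ₗ (μ (emK q n z)) ∘ₗ (emK q n)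

/-- Transpose of an endomorphism of `ℝ^n` with respect to the canonical basis. -/
def tmap (n : ℕ) (f : Eu n →ₗ[ℝ] Eu n) : Eu n →ₗ[ℝ] Eu n :=
  Matrix.toLin' (LinearMap.toMatrix' f).transpose

/-- The `GL_{q+n}(ℝ)`-action `(h.μ)(x,y) = h μ(h⁻¹x, h⁻¹y)` on brackets. -/
def act (q n : ℕ) (h : Eu (q + n) ≃ₗ[ℝ] Eu (q + n)) (μ : Bil q n) : Bil q n :=
  ((μ.comp h.symm.toLinearMap).compl₂ h.symm.toLinearMap).compr₂ h.toLinearMap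

@[simp]
theorem prK_emK (q n : ℕ) (z : Eu q) : prK q n (emK q n z) = z := by
  funext i
  simp [prK, emK]

@[simp]
theorem prP_emP (q n : ℕ) (x : Eu n) : prP q n (emP q n x) = x := by
  funext i
  simp [prP, emP]

@[simp]
theorem prK_emP (q n : ℕ) (x : Eu n) : prK q n (emP q n x) = 0 := by
  funext i
  simp [prK, emP]

@[simp]
theorem prP_emK (q n : ℕ) (z : Eu q) : prP q n (emK q n z) = 0 := by
  funext i
  simp [prP, emK]

theorem inK_iff_prP_eq_zero (q n : ℕ) (x : Eu (q + n)) : inK q n x ↔ prP q n x = 0 := by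
  refine ⟨fun hx => funext fun i => hx _ (Nat.le_add_right _ _), fun hx i hi => ?_⟩
  have hj := congrFun hx ⟨(i : ℕ) - q, by have := i.isLt; omega⟩
  simpa [prP, Nat.add_sub_cancel' hi] using hj

theorem inP_iff_prK_eq_zero (q n : ℕ) (x : Eu (q + n)) : inP q n x ↔ prK q n x = 0 :=
  ⟨fun hx => funext fun i => hx _ i.isLt, fun hx i hi => congrFun hx ⟨(i : ℕ), hi⟩⟩

theorem dotE_eq_dotE_prK_add_dotE_prP (q n : ℕ) (x y : Eu (q + n)) :
    dotE (q + n) x y =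
      dotE q (prK q n x) (prK q n y) + dotE n (prP q n x) (prP q n y) :=
  Fin.sum_univ_add _

theorem dotE_map_map_of_tmap_comp_self {n : ℕ} {f : Eu n →ₗ[ℝ] Eu n}
    (hf : tmap n f ∘ₗ f = LinearMap.id) (x y : Eu n) :
    dotE n (f x) (f y) = dotE n x y := by
  have hy : (LinearMap.toMatrix' f).transpose.mulVec (f y) = y := by
    simpa [tmap] using LinearMap.congr_fun hf y
  change f x ⬝ᵥ f y = x ⬝ᵥ y
  nth_rewrite 1 [← LinearMap.toMatrix'_mulVec f x]
  rw [← Matrix.vecMul_transpose, ← Matrix.dotProduct_mulVec, hy]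

@[simp]
theorem act_apply (q n : ℕ) (h : Eu (q + n) ≃ₗ[ℝ] Eu (q + n)) (μ : Bil q n)
    (x y : Eu (q + n)) : act q n h μ x y = h (μ (h.symm x) (h.symm y)) := rfl

theorem H1.act {q n : ℕ} {μ : Bil q n} (h1 : H1 q n μ)
    {h : Eu (q + n) ≃ₗ[ℝ] Eu (q + n)} (hK : ∀ x, inK q n (h x) ↔ inK q n x)
    (hP : ∀ x, inP q n (h x) ↔ inP q n x) : H1 q n (act q n h μ) := by
  obtain ⟨hJ, hKK, hKP⟩ := h1
  refine ⟨fun x y z => ?_, fun x y hx hy => ?_, fun x y hx hy => ?_⟩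
  · simp only [act_apply, LinearEquiv.symm_apply_apply, ← map_add, hJ, map_zero]
  · rw [act_apply, hK]
    exact hKK _ _ (by rwa [← hK, h.apply_symm_apply]) (by rwa [← hK, h.apply_symm_apply])
  · rw [act_apply, hP]
    exact hKP _ _ (by rwa [← hK, h.apply_symm_apply]) (by rwa [← hP, h.apply_symm_apply])

theorem H3.act {q n : ℕ} {μ : Bil q n} (h3 : H3 q n μ)
    (hKP : ∀ x y, inK q n x → inP q n y → inP q n (μ x y))
    {h : Eu (q + n) ≃ₗ[ℝ] Eu (q + n)} (hK : ∀ x, inK q n (h x) ↔ inK q n x)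
    (hP : ∀ x, inP q n (h x) ↔ inP q n x)
    (hdot : ∀ x y, inP q n x → inP q n y → dotE (q + n) (h x) (h y) = dotE (q + n) x y) :
    H3 q n (act q n h μ) := by
  intro z x y hz hx hy
  obtain ⟨z, rfl⟩ := h.surjective z
  obtain ⟨x, rfl⟩ := h.surjective x
  obtain ⟨y, rfl⟩ := h.surjective y
  rw [hK] at hz
  rw [hP] at hx hy
  simp only [act_apply, LinearEquiv.symm_apply_apply]
  rw [hdot _ _ (hKP _ _ hz hx) hy, hdot _ _ hx (hKP _ _ hz hy), h3 z x y hz hx hy]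

theorem H4.act {q n : ℕ} {μ : Bil q n} (h4 : H4 q n μ)
    {h : Eu (q + n) ≃ₗ[ℝ] Eu (q + n)} (hK : ∀ x, inK q n (h x) ↔ inK q n x)
    (hP : ∀ x, inP q n (h x) ↔ inP q n x) : H4 q n (act q n h μ) := by
  intro z hz hzero
  obtain ⟨z, rfl⟩ := h.surjective z
  rw [hK] at hz
  rw [h4 z hz fun x hx => ?_, map_zero]
  simpa using hzero (h x) ((hP x).2 hx)

/-- cf. Corollary 3.6 of the paper: the subgroup `GL_q(ℝ) × O(n)` leaves
the set of brackets satisfying (h1), (h3), (h4) invariant. -/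
theorem h1_h3_h4_invariant_under_GLq_On
    (q n : ℕ) (μ : Bil q n) (hμ : Skew q n μ)
    (h1 : H1 q n μ) (h3 : H3 q n μ) (h4 : H4 q n μ)
    (h : Eu (q + n) ≃ₗ[ℝ] Eu (q + n))
    (hq : Eu q ≃ₗ[ℝ] Eu q) (k : Eu n ≃ₗ[ℝ] Eu n)
    (hortho : tmap n k.toLinearMap ∘ₗ k.toLinearMap = LinearMap.id)
    (hform : ∀ x, h x = emK q n (hq (prK q n x)) + emP q n (k (prP q n x))) :
    H1 q n (act q n h μ) ∧ H3 q n (act q n h μ) ∧ H4 q n (act q n h μ) := by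
  have hprK (x) : prK q n (h x) = hq (prK q n x) := by simp [hform]
  have hprP (x) : prP q n (h x) = k (prP q n x) := by simp [hform]
  have hK (x) : inK q n (h x) ↔ inK q n x := by simp [inK_iff_prP_eq_zero, hprP]
  have hP (x) : inP q n (h x) ↔ inP q n x := by simp [inP_iff_prK_eq_zero, hprK]
  refine ⟨h1.act hK hP, h3.act h1.2.2 hK hP fun x y hx hy => ?_, h4.act hK hP⟩
  rw [inP_iff_prK_eq_zero] at hx hy
  simp only [dotE_eq_dotE_prK_add_dotE_prP, hprK, hprP, hx, hy, map_zero]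
  rw [← dotE_map_map_of_tmap_comp_self hortho (prP q n x)]
  rfl
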